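/- Under the RSS setup with consistency condition (C1) $\frac{1}{k}\sum_{i=1}^k f_{[i]}=f_X$, one has $\beta_2\ge\alpha_2$, where $\beta_2=\int_S \mathcal{A}(x)^2 f_X(x)\,dx-\big(\int_S\mathcal{A}(x)f_X(x)\,dx\big)^2$ and $\alpha_2=\int_S \mathcal{A}(x)^2 f_X(x)\,dx-\frac{1}{k}\sum_{i=1}^k\big(\int_S\mathcal{A}(x)f_{[i]}(x)\,dx\big)^2$, provided $\mathcal{A}$ is integrable with respect to each $f_{[i]}\,d\mu$ on $S$ and $\mathcal{A}^2$ is integrable with respect to $f_X\,d\mu$ on $S$. -/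

import Mathlib

open MeasureTheory

noncomputable section

/-- The product kernel `K_p(u₁,…,u_p) = ∏ⱼ k₀(uⱼ)`. -/
def Kp (k0 : ℝ → ℝ) (p : ℕ) (u : Fin p → ℝ) : ℝ := ∏ l, k0 (u l)

/-- `Δ_γ(x) = E[γ^{-p} K_p((x-X)/γ) 𝟙_S(X)]` for `X ∼ f_X`. -/
def Delta (k0 : ℝ → ℝ) (p : ℕ) (γ : ℝ) (S : Set (Fin p → ℝ))
    (fX : (Fin p → ℝ) → ℝ) (x : Fin p → ℝ) : ℝ :=
  ∫ y in S, (γ ^ p)⁻¹ * Kp k0 p (fun l => (x l - y l) / γ) * fX y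

/-- The function `𝓐(x)` from the MSE expansion:
`𝓐(x) = ∫_S γ^{-p} K_p((y-x)/γ)/Δ_γ(y) f_X(y) dy + log(Δ_γ(x)) 𝟙_S(x)`. -/
def calA (k0 : ℝ → ℝ) (p : ℕ) (γ : ℝ) (S : Set (Fin p → ℝ))
    (fX : (Fin p → ℝ) → ℝ) (x : Fin p → ℝ) : ℝ :=
  (∫ y in S, (γ ^ p)⁻¹ * Kp k0 p (fun l => (y l - x l) / γ) /
      Delta k0 p γ S fX y * fX y)
    + S.indicator (fun x' => Real.log (Delta k0 p γ S fX x')) x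

/-- Section 2.4 of Amini–Mahdizadeh (2015): under the RSS setup with the
consistency condition (C1) `(1/k) ∑ i, f i = fX`, one has `β₂ ≥ α₂`, where
`β₂ = ∫_S 𝓐² fX dμ - (∫_S 𝓐 fX dμ)²` is the SRS variance component (Joe, 1989)
and `α₂ = ∫_S 𝓐² fX dμ - (1/k) ∑ i (∫_S 𝓐 f_i dμ)²` is the RSS variance
component, provided `𝓐` is integrable with respect to each `f_i dμ` on `S` and
`𝓐²` is integrable with respect to `fX dμ` on `S`. -/
theorem rss_beta2_ge_alpha2
    (p k : ℕ) (hp : 0 < p) (hk : 0 < k)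
    -- the densities of the (judgement) order statistics
    (f : Fin k → (Fin p → ℝ) → ℝ)
    (hf_meas : ∀ i, Measurable (f i))
    (hf_nonneg : ∀ i x, 0 ≤ f i x)
    (hf_pdf : ∀ i, ∫ x, f i x = 1)
    -- the population density and the consistency condition (C1)
    (fX : (Fin p → ℝ) → ℝ)
    (hC1 : ∀ x, (k : ℝ)⁻¹ * ∑ i, f i x = fX x)
    -- the bounded set `S` on which `f_X` is bounded below by a positive constant
    (S : Set (Fin p → ℝ)) (hS_meas : MeasurableSet S)
    (hS_bdd : Bornology.IsBounded S)
    (hfX_pos : ∃ c > 0, ∀ x ∈ S, c ≤ fX x)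
    -- the univariate kernel and the bandwidth
    (k0 : ℝ → ℝ) (hk0_meas : Measurable k0)
    (γ : ℝ) (hγ : 0 < γ)
    -- integrability of `𝓐` w.r.t. each `f_i dμ` on `S` and of `𝓐²` w.r.t.
    -- `fX dμ` on `S`
    (hA_int : ∀ i, IntegrableOn (fun x => calA k0 p γ S fX x * f i x) S)
    (hA_sq_int : IntegrableOn (fun x => (calA k0 p γ S fX x) ^ 2 * fX x) S) :
    (∫ x in S, (calA k0 p γ S fX x) ^ 2 * fX x)
        - (∫ x in S, calA k0 p γ S fX x * fX x) ^ 2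
      ≥ (∫ x in S, (calA k0 p γ S fX x) ^ 2 * fX x)
        - (k : ℝ)⁻¹ * ∑ i, (∫ x in S, calA k0 p γ S fX x * f i x) ^ 2 := by
  have mean_eq : (∫ x in S, calA k0 p γ S fX x * fX x)
      = (k : ℝ)⁻¹ * ∑ i, ∫ x in S, calA k0 p γ S fX x * f i x := by
    rw [← integral_finsetSum _ fun i _ => hA_int i, ← integral_const_mul]
    refine integral_congr_ae (.of_forall fun x => ?_)
    simp only [← Finset.mul_sum]
    rw [mul_left_comm, hC1 x]
  have hk' : (0 : ℝ) < k := Nat.cast_pos.mpr hk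
  have cauchy_schwarz := sq_sum_le_card_mul_sum_sq (s := Finset.univ)
    (f := fun i => ∫ x in S, calA k0 p γ S fX x * f i x)
  rw [Finset.card_univ, Fintype.card_fin] at cauchy_schwarz
  rw [mean_eq, ge_iff_le, sub_le_sub_iff_left, mul_pow, pow_two (k : ℝ)⁻¹, mul_assoc]
  gcongr
  rwa [inv_mul_le_iff₀ hk']

end
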